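/- arXiv:1310.3119 — 6 statements merged into one kernel-verified Lean document; each statement's English description precedes it below -/
import Mathlib

section
/- Let ρ > 1 be a real number, x₀ ∈ ℝ, C ≥ 0, and F : ℕ → ℝ a reward sequence with |F i| ≤ C for all i ≥ 1. Define the wealth sequence x by x 0 = x₀ and x n = ρ·x (n−1) + F n for n ≥ 1. Then the series D = ∑_{i=1}^{∞} F i · ρ^{−i} converges, and liminf_{n→∞} x n > −∞ if and only if D ≥ −x₀. -/
open Filter

/-- The wealth after `n` steps, discounted to time `0`, is the initial wealth plus the
discounted rewards collected so far. -/
lemma wealth_eq_pow_mul {ρ : ℝ} (hρ : ρ ≠ 0) {F x : ℕ → ℝ}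
    (hrec : ∀ n, x (n + 1) = ρ * x n + F (n + 1)) (n : ℕ) :
    x n = ρ ^ n * (x 0 + ∑ i ∈ Finset.range n, F (i + 1) * ρ ^ (-((i : ℤ) + 1))) := by
  induction n with
  | zero => simp
  | succ n ih =>
    have hpow : ρ ^ (n + 1) * ρ ^ (-((n : ℤ) + 1)) = 1 := by
      rw [zpow_neg, ← Nat.cast_succ, zpow_natCast]
      exact mul_inv_cancel₀ (pow_ne_zero _ hρ)
    rw [hrec, ih, Finset.sum_range_succ]
    linear_combination (-F (n + 1)) * hpow

lemma abs_discounted_reward_le {ρ C : ℝ} (hρ : 0 < ρ) {F : ℕ → ℝ}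
    (hF : ∀ i, |F (i + 1)| ≤ C) (i : ℕ) :
    |F (i + 1) * ρ ^ (-((i : ℤ) + 1))| ≤ C / ρ * ρ⁻¹ ^ i := by
  have hpow : ρ ^ (-((i : ℤ) + 1)) = ρ⁻¹ * ρ⁻¹ ^ i := by
    rw [zpow_neg, ← Nat.cast_succ, zpow_natCast, ← inv_pow, pow_succ']
  rw [hpow, abs_mul, abs_of_pos (by positivity : 0 < ρ⁻¹ * ρ⁻¹ ^ i), div_eq_mul_inv, mul_assoc]
  gcongr
  exact hF i

lemma summable_discounted_reward {ρ C : ℝ} (hρ : 1 < ρ) {F : ℕ → ℝ}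
    (hF : ∀ i, |F (i + 1)| ≤ C) :
    Summable (fun i : ℕ => F (i + 1) * ρ ^ (-((i : ℤ) + 1))) :=
  .of_norm_bounded
    ((summable_geometric_of_lt_one (by positivity) (inv_lt_one_of_one_lt₀ hρ)).mul_left (C / ρ))
    (abs_discounted_reward_le (by positivity) hF)

/-- The wealth stays within bounded distance of the compounded total discounted value. -/
lemma abs_wealth_sub_pow_mul_le {ρ C : ℝ} (hρ : 1 < ρ) {F x : ℕ → ℝ}
    (hF : ∀ i, |F (i + 1)| ≤ C) (hrec : ∀ n, x (n + 1) = ρ * x n + F (n + 1)) (n : ℕ) :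
    |x n - ρ ^ n * (x 0 + ∑' i : ℕ, F (i + 1) * ρ ^ (-((i : ℤ) + 1)))| ≤ C / (ρ - 1) := by
  have hρ0 : 0 < ρ := by positivity
  have hρ1 : 0 < ρ - 1 := sub_pos.2 hρ
  have htail := dist_le_of_le_geometric_of_tendsto ρ⁻¹ (C / ρ) (inv_lt_one_of_one_lt₀ hρ)
    (f := fun n => ∑ i ∈ Finset.range n, F (i + 1) * ρ ^ (-((i : ℤ) + 1)))
    (fun n => by
      rw [dist_comm, Real.dist_eq, Finset.sum_range_succ, add_sub_cancel_left]
      exact abs_discounted_reward_le hρ0 hF n)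
    (summable_discounted_reward hρ hF).hasSum.tendsto_sum_nat n
  rw [Real.dist_eq] at htail
  have hbound : ρ ^ n * (C / ρ * ρ⁻¹ ^ n / (1 - ρ⁻¹)) = C / (ρ - 1) := by
    have hinv : 1 - ρ⁻¹ = (ρ - 1) / ρ := by field_simp
    rw [hinv, inv_pow]
    field_simp
  rw [wealth_eq_pow_mul hρ0.ne' hrec n, ← mul_sub, add_sub_add_left_eq_sub, abs_mul,
    abs_of_pos (pow_pos hρ0 n), ← hbound]
  gcongr

/-- For a wealth sequence with bounded rewards, the discounted reward series
`D = ∑_{i=1}^∞ F i * ρ^{-i}` converges, and `liminf xₙ > -∞` iff `D ≥ -x₀`. -/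
theorem win_iff_discounted_threshold (ρ x₀ C : ℝ) (hρ : 1 < ρ) (hC : 0 ≤ C)
    (F : ℕ → ℝ) (hF : ∀ i : ℕ, 1 ≤ i → |F i| ≤ C) (x : ℕ → ℝ)
    (h0 : x 0 = x₀) (hrec : ∀ n : ℕ, 1 ≤ n → x n = ρ * x (n - 1) + F n) :
    Summable (fun i : ℕ => F (i + 1) * ρ ^ (-((i : ℤ) + 1))) ∧
      ((⊥ < Filter.liminf (fun n : ℕ => ((x n : ℝ) : EReal)) Filter.atTop) ↔
        (∑' i : ℕ, F (i + 1) * ρ ^ (-((i : ℤ) + 1))) ≥ -x₀) := by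
  have hF' : ∀ i, |F (i + 1)| ≤ C := fun i => hF (i + 1) (Nat.le_add_left 1 i)
  have hclose := abs_wealth_sub_pow_mul_le hρ hF' fun n => hrec (n + 1) (Nat.le_add_left 1 n)
  rw [h0] at hclose
  refine ⟨summable_discounted_reward hρ hF', ?_⟩
  set D := ∑' i : ℕ, F (i + 1) * ρ ^ (-((i : ℤ) + 1))
  constructor
  · intro h
    by_contra! hD
    have hlim : Tendsto x atTop atBot := by
      refine tendsto_atBot_mono (fun n => ?_) (tendsto_atBot_add_const_right atTop (C / (ρ - 1))
        ((tendsto_pow_atTop_atTop_of_one_lt hρ).atTop_mul_const_of_neg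
          (show x₀ + D < 0 by linarith)))
      linarith [(abs_le.1 (hclose n)).2]
    exact h.ne' (EReal.tendsto_coe_atBot.comp hlim).liminf_eq
  · intro hD
    refine (EReal.bot_lt_coe (-(C / (ρ - 1)))).trans_le
      (le_liminf_of_le (by isBoundedDefault) (Eventually.of_forall fun n => ?_))
    have hpos : 0 ≤ ρ ^ n * (x₀ + D) := mul_nonneg (by positivity) (by linarith)
    exact EReal.coe_le_coe_iff.2 (by linarith [(abs_le.1 (hclose n)).1])
end

section
/- Let ρ > 1 be a real number, x₀ ∈ ℝ, C ≥ 0, and F : ℕ → ℝ a reward sequence with |F i| ≤ C for all i ≥ 1, such that ∑_{i=1}^{∞} F i · ρ^{−i} = −x₀. Define the wealth sequence x by x 0 = x₀ and x n = ρ·x (n−1) + F n for n ≥ 1. Then for every n ∈ ℕ, x n ≥ −C/(ρ−1); in particular the infimum of the wealth along the run is finite. -/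
/-- The discounted value of a solution of `x (n + 1) = ρ * x n + F (n + 1)` is the initial value
plus the partial sum of the discounted inhomogeneous terms. -/
theorem discounted_eq_add_sum {ρ : ℝ} (hρ : ρ ≠ 0) {F x : ℕ → ℝ}
    (hrec : ∀ n, x (n + 1) = ρ * x n + F (n + 1)) (n : ℕ) :
    x n / ρ ^ n = x 0 + ∑ i ∈ Finset.range n, F (i + 1) / ρ ^ (i + 1) := by
  induction n with
  | zero => simp
  | succ n ih =>
    rw [Finset.sum_range_succ, ← add_assoc, ← ih, hrec, pow_succ]
    field_simp

/-- If the inhomogeneous terms are at most `C`, then `x n + C / (ρ - 1)`, discounted to time `0`,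
is nonincreasing. -/
theorem antitone_discounted_add {ρ C : ℝ} (hρ : 1 < ρ) {F x : ℕ → ℝ}
    (hF : ∀ n, F (n + 1) ≤ C) (hrec : ∀ n, x (n + 1) = ρ * x n + F (n + 1)) :
    Antitone fun n => (x n + C / (ρ - 1)) / ρ ^ n := by
  have hρ0 : 0 < ρ := by linarith
  have hρ1 : ρ - 1 ≠ 0 := by linarith
  have hK : C + C / (ρ - 1) = ρ * (C / (ρ - 1)) := by
    field_simp
    ring
  refine antitone_nat_of_succ_le fun n => ?_
  calc (x (n + 1) + C / (ρ - 1)) / ρ ^ (n + 1)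
      ≤ (ρ * (x n + C / (ρ - 1))) / ρ ^ (n + 1) := by
        gcongr
        linarith [hF n, hrec n]
    _ = (x n + C / (ρ - 1)) / ρ ^ n := by
        rw [pow_succ']
        exact mul_div_mul_left _ _ hρ0.ne'

/-- In the borderline case where the discounted reward series equals exactly `-x₀`
and rewards are bounded by `C`, the wealth never drops below `-C/(ρ-1)`. -/
theorem wealth_bounded_below_borderline (ρ x₀ C : ℝ) (hρ : 1 < ρ) (hC : 0 ≤ C)
    (F : ℕ → ℝ) (hF : ∀ i : ℕ, 1 ≤ i → |F i| ≤ C)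
    (hD : HasSum (fun i : ℕ => F (i + 1) * ρ ^ (-((i : ℤ) + 1))) (-x₀))
    (x : ℕ → ℝ)
    (h0 : x 0 = x₀) (hrec : ∀ n : ℕ, 1 ≤ n → x n = ρ * x (n - 1) + F n) :
    ∀ n : ℕ, x n ≥ -C / (ρ - 1) := by
  have hρ0 : 0 < ρ := by linarith
  have hstep (n : ℕ) : x (n + 1) = ρ * x n + F (n + 1) := hrec (n + 1) n.succ_pos
  have hterm (i : ℕ) : F (i + 1) * ρ ^ (-((i : ℤ) + 1)) = F (i + 1) / ρ ^ (i + 1) := by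
    rw [zpow_neg, div_eq_mul_inv]
    norm_cast
  simp only [hterm] at hD
  have hx : Filter.Tendsto (fun n => x n / ρ ^ n) Filter.atTop (nhds 0) := by
    simpa [discounted_eq_add_sum hρ0.ne' hstep, h0] using hD.tendsto_sum_nat.const_add x₀
  have hK : Filter.Tendsto (fun n : ℕ => C / (ρ - 1) / ρ ^ n) Filter.atTop (nhds 0) :=
    (tendsto_pow_atTop_atTop_of_one_lt hρ).const_div_atTop _
  have hlim : Filter.Tendsto (fun n => (x n + C / (ρ - 1)) / ρ ^ n) Filter.atTop (nhds 0) := by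
    simpa [add_div] using hx.add hK
  intro n
  have hanti := antitone_discounted_add hρ
    (fun n => (le_abs_self _).trans (hF (n + 1) n.succ_pos)) hstep
  have hnonneg := mul_nonneg (hanti.le_of_tendsto hlim n) (pow_pos hρ0 n).le
  rw [div_mul_cancel₀ _ (pow_pos hρ0 n).ne'] at hnonneg
  rw [neg_div]
  linarith
end

section
/- Let ρ > 1 be a real number, S a finite type of states, Act a type of actions, avail : S → Set Act an availability map, Succ : S → Act → Set S a successor map, and F : S → Act → ℝ a gain function. Suppose L : S → ℝ satisfies the constraints L s ≤ (1/ρ)·(L t − F s a) for all s ∈ S, a ∈ avail s, and t ∈ Succ s a. Let (s_n)_{n≥0}, (a_n)_{n≥1}, (x_n)_{n≥0} be a trajectory, i.e. a_{n+1} ∈ avail (s_n), s_{n+1} ∈ Succ (s_n) (a_{n+1}), and x_{n+1} = ρ·x_n + F (s_n) (a_{n+1}) for all n ≥ 0. If x_0 < L (s_0), then for all n ∈ ℕ, L (s_n) − x_n ≥ ρ^n·(L (s_0) − x_0); consequently x_n tends to −∞ as n → ∞. -/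
open Filter

/-- If `L` is a feasible solution of the LP for the almost-sure losing thresholds,
then along any trajectory starting with wealth below `L (s 0)` the gap
`L (s n) - x n` grows geometrically, and the wealth tends to `-∞`. -/
theorem lp_lower_bound_losing {S Act : Type*} [Fintype S]
    (ρ : ℝ) (hρ : 1 < ρ)
    (avail : S → Set Act) (Succ : S → Act → Set S) (F : S → Act → ℝ)
    (L : S → ℝ)
    (hL : ∀ s : S, ∀ a ∈ avail s, ∀ t ∈ Succ s a, L s ≤ (1 / ρ) * (L t - F s a))
    (s : ℕ → S) (a : ℕ → Act) (x : ℕ → ℝ)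
    (ha : ∀ n : ℕ, a (n + 1) ∈ avail (s n))
    (hs : ∀ n : ℕ, s (n + 1) ∈ Succ (s n) (a (n + 1)))
    (hx : ∀ n : ℕ, x (n + 1) = ρ * x n + F (s n) (a (n + 1)))
    (hinit : x 0 < L (s 0)) :
    (∀ n : ℕ, L (s n) - x n ≥ ρ ^ n * (L (s 0) - x 0)) ∧
      Filter.Tendsto x Filter.atTop Filter.atBot := by
  have hρ0 : 0 < ρ := zero_lt_one.trans hρ
  have gap : ∀ n : ℕ, ρ ^ n * (L (s 0) - x 0) ≤ L (s n) - x n := by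
    intro n
    induction n with
    | zero => simp
    | succ n ih =>
      have hstep := hL (s n) (a (n + 1)) (ha n) (s (n + 1)) (hs n)
      rw [one_div, le_inv_mul_iff₀ hρ0] at hstep
      have hmul := mul_le_mul_of_nonneg_left ih hρ0.le
      rw [hx n, pow_succ]
      linarith
  refine ⟨gap, ?_⟩
  obtain ⟨C, hC⟩ := (Set.finite_range L).bddAbove
  have hgrow : Tendsto (fun n : ℕ => ρ ^ n * (L (s 0) - x 0)) atTop atTop :=
    (tendsto_pow_atTop_atTop_of_one_lt hρ).atTop_mul_const (sub_pos.2 hinit)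
  refine tendsto_atBot_mono (fun n => ?_)
    (tendsto_atBot_add_const_left atTop C (tendsto_neg_atTop_atBot.comp hgrow))
  have hbound : L (s n) ≤ C := hC (Set.mem_range_self (s n))
  simp only [Function.comp_apply]
  linarith [gap n]
end

section
/- Let ρ > 1 be a real number, S a finite type of states, Act a type of actions, avail : S → Set Act an availability map, Succ : S → Act → Set S a successor map, and F : S → Act → ℝ a gain function. Suppose U : S → ℝ satisfies the constraints U s ≥ (1/ρ)·(U t − F s a) for all s ∈ S, a ∈ avail s, and t ∈ Succ s a. Let (s_n)_{n≥0}, (a_n)_{n≥1}, (x_n)_{n≥0} be a trajectory, i.e. a_{n+1} ∈ avail (s_n), s_{n+1} ∈ Succ (s_n) (a_{n+1}), and x_{n+1} = ρ·x_n + F (s_n) (a_{n+1}) for all n ≥ 0. If x_0 ≥ U (s_0), then x_n ≥ U (s_n) for all n ∈ ℕ; in particular x_n ≥ min_{s ∈ S} U s for all n, so liminf_{n→∞} x_n > −∞. -/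
open Filter

/-- If `U` is a feasible solution of the LP for the almost-sure winning thresholds,
then along any trajectory starting with wealth at least `U (s 0)` the wealth stays
above `U` of the current state, hence above `min_{s} U s`, so `liminf xₙ > -∞`. -/
theorem lp_upper_bound_winning {S Act : Type*} [Fintype S]
    (ρ : ℝ) (hρ : 1 < ρ)
    (avail : S → Set Act) (Succ : S → Act → Set S) (F : S → Act → ℝ)
    (U : S → ℝ)
    (hU : ∀ s : S, ∀ a ∈ avail s, ∀ t ∈ Succ s a, U s ≥ (1 / ρ) * (U t - F s a))
    (s : ℕ → S) (a : ℕ → Act) (x : ℕ → ℝ)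
    (ha : ∀ n : ℕ, a (n + 1) ∈ avail (s n))
    (hs : ∀ n : ℕ, s (n + 1) ∈ Succ (s n) (a (n + 1)))
    (hx : ∀ n : ℕ, x (n + 1) = ρ * x n + F (s n) (a (n + 1)))
    (hinit : x 0 ≥ U (s 0)) :
    (∀ n : ℕ, x n ≥ U (s n)) ∧ (∀ n : ℕ, x n ≥ ⨅ t : S, U t) ∧
      ⊥ < Filter.liminf (fun n : ℕ => ((x n : ℝ) : EReal)) Filter.atTop := by
  have above : ∀ n : ℕ, U (s n) ≤ x n := by
    intro n
    induction n with
    | zero => exact hinit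
    | succ n ih =>
      have hρ0 : 0 < ρ := by linarith
      have h : (1 / ρ) * (U (s (n + 1)) - F (s n) (a (n + 1))) ≤ U (s n) :=
        hU _ _ (ha n) _ (hs n)
      rw [one_div_mul_eq_div, div_le_iff₀' hρ0] at h
      have h' := mul_le_mul_of_nonneg_left ih hρ0.le
      rw [hx]
      linarith
  have above_min : ∀ n : ℕ, ⨅ t : S, U t ≤ x n := fun n =>
    (ciInf_le (Set.finite_range U).bddBelow (s n)).trans (above n)
  refine ⟨above, above_min, (EReal.bot_lt_coe (⨅ t : S, U t)).trans_le ?_⟩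
  exact le_liminf_of_le (by isBoundedDefault)
    (Eventually.of_forall fun n => EReal.coe_le_coe_iff.2 (above_min n))
end

section
/- There exists a sequence x : ℕ → ℚ such that x 0 = 1/2, for every n either x (n+1) = (3/2)·x n + 1/2 or x (n+1) = (3/2)·x n − 1/2, the values x n all lie in the interval [0,1), and x is injective (the values x n are pairwise distinct). -/
/-- The wealth update that adds `1/2` below `1/3` and subtracts `1/2` from `1/3` on. -/
def wealthStep (y : ℚ) : ℚ :=
  if y < 1 / 3 then (3 / 2) * y + 1 / 2 else (3 / 2) * y - 1 / 2

lemma wealthStep_eq_or (y : ℚ) :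
    wealthStep y = (3 / 2) * y + 1 / 2 ∨ wealthStep y = (3 / 2) * y - 1 / 2 := by
  unfold wealthStep
  split_ifs <;> simp

lemma wealthStep_mem_Ico {y : ℚ} (hy : 0 ≤ y ∧ y < 1) :
    0 ≤ wealthStep y ∧ wealthStep y < 1 := by
  unfold wealthStep
  split_ifs <;> constructor <;> linarith

/-- A sequence started at `1/2` and driven by `y ↦ (3/2) y ± 1/2` has exact denominator
`2 ^ (n + 1)` at time `n`. -/
lemma exists_odd_eq_mul_two_pow {x : ℕ → ℚ} (h0 : x 0 = 1 / 2)
    (hstep : ∀ n, x (n + 1) = (3 / 2) * x n + 1 / 2 ∨ x (n + 1) = (3 / 2) * x n - 1 / 2)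
    (n : ℕ) : ∃ k : ℤ, Odd k ∧ x n * 2 ^ (n + 1) = k := by
  induction n with
  | zero => exact ⟨1, odd_one, by norm_num [h0]⟩
  | succ n ih =>
    obtain ⟨k, hk, hx⟩ := ih
    have h3 : Odd (3 * k) := Odd.mul (by decide) hk
    have h2 : Even ((2 : ℤ) ^ (n + 1)) := even_two.pow_of_ne_zero n.succ_ne_zero
    rcases hstep n with h | h
    · refine ⟨3 * k + 2 ^ (n + 1), h3.add_even h2, ?_⟩
      push_cast
      rw [h, ← hx]
      ring
    · refine ⟨3 * k - 2 ^ (n + 1), h3.sub_even h2, ?_⟩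
      push_cast
      rw [h, ← hx]
      ring

lemma injective_of_odd_eq_mul_two_pow {x : ℕ → ℚ}
    (hx : ∀ n, ∃ k : ℤ, Odd k ∧ x n * 2 ^ (n + 1) = k) : Function.Injective x := by
  refine Function.Injective.of_lt_imp_ne fun m n hmn h => ?_
  obtain ⟨d, rfl⟩ := Nat.exists_eq_add_of_lt hmn
  obtain ⟨k, -, hk⟩ := hx m
  obtain ⟨l, hl, hl'⟩ := hx (m + d + 1)
  have key : (l : ℚ) = ((2 * (k * 2 ^ d) : ℤ) : ℚ) := by
    push_cast
    rw [← hl', ← h, ← hk]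
    ring
  rw [Int.cast_injective key] at hl
  exact Int.not_odd_iff_even.mpr (even_two_mul _) hl

/-- There is an infinite run of the single-state solvency MDP with interest `3/2`
and rewards `±1/2` starting at wealth `1/2` all of whose wealths stay in `[0,1)`
and are pairwise distinct. -/
theorem exists_injective_wealth_sequence :
    ∃ x : ℕ → ℚ, x 0 = 1 / 2 ∧
      (∀ n : ℕ, x (n + 1) = (3 / 2) * x n + 1 / 2 ∨ x (n + 1) = (3 / 2) * x n - 1 / 2) ∧
      (∀ n : ℕ, 0 ≤ x n ∧ x n < 1) ∧
      Function.Injective x := by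
  have hstep (n : ℕ) : wealthStep^[n + 1] (1 / 2) = (3 / 2) * wealthStep^[n] (1 / 2) + 1 / 2 ∨
      wealthStep^[n + 1] (1 / 2) = (3 / 2) * wealthStep^[n] (1 / 2) - 1 / 2 := by
    rw [Function.iterate_succ_apply']
    exact wealthStep_eq_or _
  refine ⟨fun n => wealthStep^[n] (1 / 2), rfl, hstep, fun n => ?_,
    injective_of_odd_eq_mul_two_pow (exists_odd_eq_mul_two_pow rfl hstep)⟩
  induction n with
  | zero => norm_num
  | succ n ih =>
    simp only [Function.iterate_succ_apply']
    exact wealthStep_mem_Ico ih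
end

section
/- Let ρ ≥ 1 and λ ≥ 0 be real numbers, and let w, x : ℕ → ℝ and c : ℕ → ℝ be sequences such that w 0 − x 0 ≤ λ and for every i ≥ 1, x i = ρ·x (i−1) + c i and w i ≤ ρ·w (i−1) + c i + λ. Then for every i ∈ ℕ, w i − x i ≤ (i+1)·λ·ρ^i. -/
/-- Discretization error bound: if the true wealth evolves by `x i = ρ·x (i-1) + c i`
and the rounded wealth satisfies `w i ≤ ρ·w (i-1) + c i + lam` with initial error at
most `lam`, then after `i` steps the error is at most `(i+1)·lam·ρ^i`. -/
theorem discretization_error_bound (ρ lam : ℝ) (hρ : 1 ≤ ρ) (hlam : 0 ≤ lam)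
    (w x c : ℕ → ℝ) (h0 : w 0 - x 0 ≤ lam)
    (hx : ∀ i : ℕ, 1 ≤ i → x i = ρ * x (i - 1) + c i)
    (hw : ∀ i : ℕ, 1 ≤ i → w i ≤ ρ * w (i - 1) + c i + lam) :
    ∀ i : ℕ, w i - x i ≤ (i + 1) * lam * ρ ^ i := by
  intro i
  induction i with
  | zero => simpa using h0
  | succ k ih =>
    have hxk := hx (k + 1) (Nat.le_add_left 1 k)
    have hwk := hw (k + 1) (Nat.le_add_left 1 k)
    rw [Nat.add_sub_cancel] at hxk hwk
    have hlam_le : lam ≤ lam * ρ ^ (k + 1) :=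
      le_mul_of_one_le_right hlam (one_le_pow₀ hρ)
    calc w (k + 1) - x (k + 1) ≤ ρ * (w k - x k) + lam := by linarith
      _ ≤ ρ * ((k + 1) * lam * ρ ^ k) + lam * ρ ^ (k + 1) := by gcongr
      _ = ((k + 1 : ℕ) + 1) * lam * ρ ^ (k + 1) := by push_cast; ring
end
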